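/- Let λ⁽ᵏ⁺¹⁾ = (λ₁ ≥ ⋯ ≥ λ_{k+1}) and λ⁽ᵏ⁾ = (μ₁ ≥ ⋯ ≥ μ_k) be real sequences. There exists a (k+1)×(k+1) Hermitian matrix with eigenvalues λ₁,…,λ_{k+1} whose upper-left k×k submatrix has eigenvalues μ₁,…,μ_k if and only if the interlacing inequalities λⱼ ≥ μⱼ ≥ λⱼ₊₁ hold for all 1 ≤ j ≤ k. -/

import Mathlib

open Polynomial

lemma aux_weights_strict (k : ℕ) (lam : Fin (k + 1) → ℝ) (mu : Fin k → ℝ)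
    (h1 : ∀ (p : Fin k) (q : Fin (k+1)), q.val ≤ p.val → mu p < lam q)
    (h2 : ∀ (p : Fin k) (q : Fin (k+1)), p.val < q.val → lam q < mu p) :
    ∃ (c : ℝ) (b : Fin k → ℝ), (∀ j, 0 ≤ b j) ∧
      ∏ i, (X - C (lam i)) = (X - C c) * ∏ j, (X - C (mu j))
        - ∑ j, C (b j) * ∏ i ∈ Finset.univ.erase j, (X - C (mu i)) := by
  have hmu : ∀ i j : Fin k, i < j → mu j < mu i := fun i j hij =>
    (h1 j j.castSucc (by simp)).trans (h2 i j.castSucc (by simpa using hij))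
  have hinj : Function.Injective mu := by
    intro i j h
    rcases lt_trichotomy i j with hl | hl | hl
    · have := hmu i j hl; linarith
    · exact hl
    · have := hmu j i hl; linarith
  set P : ℝ[X] := ∏ i, (X - C (lam i)) with hP
  set Q : ℝ[X] := ∏ j, (X - C (mu j)) with hQ
  have hPm : P.Monic := monic_prod_of_monic _ _ fun i _ => monic_X_sub_C _
  have hQm : Q.Monic := monic_prod_of_monic _ _ fun i _ => monic_X_sub_C _
  have hPd : P.natDegree = k + 1 := by simp [hP]
  have hQd : Q.natDegree = k := by simp [hQ]
  have hPd' : P.degree = (k+1 : ℕ) := by rw [degree_eq_natDegree hPm.ne_zero, hPd]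
  have hQd' : Q.degree = (k : ℕ) := by rw [degree_eq_natDegree hQm.ne_zero, hQd]
  have hq : (P /ₘ Q).Monic := by
    unfold Monic
    rw [leadingCoeff_divByMonic_of_monic hQm, hPm]
    rw [hPd', hQd']; exact_mod_cast Nat.le_succ k
  have hq1 : (P /ₘ Q).natDegree = 1 := by
    rw [natDegree_divByMonic _ hQm, hPd, hQd]; omega
  have hqe := hq.eq_X_add_C hq1
  have hdiv := modByMonic_add_div P Q
  have hQev : ∀ j, Q.eval (mu j) = 0 := by
    intro j
    rw [hQ, eval_prod]
    exact Finset.prod_eq_zero (Finset.mem_univ j) (by simp)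
  have hne : ∀ j, ∏ i ∈ Finset.univ.erase j, (mu j - mu i) ≠ 0 := by
    intro j
    rw [Finset.prod_ne_zero_iff]
    intro i hi h
    exact (Finset.ne_of_mem_erase hi) (hinj (by linarith))
  refine ⟨-(P /ₘ Q).coeff 0, fun j => -(P.eval (mu j)) / ∏ i ∈ Finset.univ.erase j, (mu j - mu i),
    ?_, ?_⟩
  · intro j
    have hPe : P.eval (mu j) = (mu j - lam j.castSucc) * ((mu j - lam j.succ) *
        ∏ i ∈ Finset.univ.erase j, (mu j - lam (j.castSucc.succAbove i))) := by
      rw [hP, eval_prod, Fin.prod_univ_succAbove _ j.castSucc,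
        ← Finset.mul_prod_erase Finset.univ _ (Finset.mem_univ j)]
      simp
    have hpos : 0 < ∏ i ∈ Finset.univ.erase j, 
        ((mu j - lam (j.castSucc.succAbove i)) / (mu j - mu i)) := by
      apply Finset.prod_pos
      intro i hi
      rcases lt_or_gt_of_ne (Finset.ne_of_mem_erase hi) with hl | hl
      · rw [Fin.succAbove_of_castSucc_lt _ _ (by simpa using hl)]
        have := h1 j i.castSucc (by simpa using hl.le)
        have := hmu i j hl
        exact div_pos_of_neg_of_neg (by linarith) (by linarith)
      · rw [Fin.succAbove_of_le_castSucc _ _ (by simpa using hl.le)]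
        have := h2 j i.succ (by simp; omega)
        have := hmu j i hl
        exact div_pos (by linarith) (by linarith)
    rw [Finset.prod_div_distrib] at hpos
    have e1 := h1 j j.castSucc (by simp)
    have e2 := h2 j j.succ (by simp)
    have e3 : 0 ≤ (lam j.castSucc - mu j) * (mu j - lam j.succ) := by
      apply mul_nonneg <;> linarith
    have := mul_nonneg e3 hpos.le
    simp only
    rw [hPe]
    have e4 : ∀ a b c d e : ℝ, -((a - b) * ((a - c) * d)) / e = (b - a) * (a - c) * (d / e) := by
      intros; ring
    rw [e4]
    exact this
  · have hr : P %ₘ Q = - ∑ j, C (-(P.eval (mu j)) / ∏ i ∈ Finset.univ.erase j, (mu j - mu i)) *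
        ∏ i ∈ Finset.univ.erase j, (X - C (mu i)) := by
      apply eq_of_degrees_lt_of_eval_index_eq (s := Finset.univ) (v := mu) (hvs := hinj.injOn)
      · simpa [hQd'] using degree_modByMonic_lt P hQm
      · rw [degree_neg]
        simp only [Finset.card_univ, Fintype.card_fin]
        rw [← mem_degreeLT]
        apply Submodule.sum_mem
        intro j _
        rw [mem_degreeLT]
        rw [← smul_eq_C_mul]
        refine (degree_smul_le _ _).trans_lt ?_
        rw [degree_prod]
        simp [degree_X_sub_C]
        exact j.pos
      · intro j _
        have : (P %ₘ Q).eval (mu j) = P.eval (mu j) := by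
          conv_rhs => rw [← hdiv]
          simp [hQev]
        rw [this, eval_neg, eval_finsetSum, Finset.sum_eq_single j]
        · simp only [eval_mul, eval_C, eval_prod, eval_sub, eval_X]
          rw [div_mul_cancel₀ _ (hne j)]; ring
        · intro i _ hij
          have hz : eval (mu j) (∏ l ∈ Finset.univ.erase i, (X - C (mu l))) = 0 := by
            rw [eval_prod]
            exact Finset.prod_eq_zero (i := j)
              (Finset.mem_erase.mpr ⟨hij.symm, Finset.mem_univ _⟩) (by simp)
          rw [eval_mul, hz, mul_zero]
        · simp
    rw [hr, hqe] at hdiv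
    rw [C_neg]
    conv_lhs => rw [← hdiv]
    ring

lemma aux_weights (k : ℕ) (lam : Fin (k + 1) → ℝ) (mu : Fin k → ℝ)
    (h1 : ∀ (p : Fin k) (q : Fin (k+1)), q.val ≤ p.val → mu p ≤ lam q)
    (h2 : ∀ (p : Fin k) (q : Fin (k+1)), p.val < q.val → lam q ≤ mu p)
    (hlam : Antitone lam) (hmu : Antitone mu) :
    ∃ (c : ℝ) (b : Fin k → ℝ), (∀ j, 0 ≤ b j) ∧
      ∏ i, (X - C (lam i)) = (X - C c) * ∏ j, (X - C (mu j))
        - ∑ j, C (b j) * ∏ i ∈ Finset.univ.erase j, (X - C (mu i)) := by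
  induction k with
  | zero => exact ⟨lam 0, fun _ => 0, by simp, by simp⟩
  | succ k ih =>
    by_cases hs : ∃ (j : Fin (k+1)) (q : Fin (k+2)), (q = j.castSucc ∨ q = j.succ) ∧ lam q = mu j
    · obtain ⟨j, q, hq, he⟩ := hs
      have hqv : q.val = j.val ∨ q.val = j.val + 1 := by
        rcases hq with rfl | rfl <;> simp
      obtain ⟨c, b, hb, hcb⟩ := ih (lam ∘ q.succAbove) (mu ∘ j.succAbove)
        (by
          intro p r hpr
          apply h1
          simp only [Fin.succAbove, Fin.lt_def]
          split_ifs <;> simp at * <;> omega)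
        (by
          intro p r hpr
          apply h2
          simp only [Fin.succAbove, Fin.lt_def]
          split_ifs <;> simp at * <;> omega)
        (hlam.comp_monotone (Fin.strictMono_succAbove _).monotone)
        (hmu.comp_monotone (Fin.strictMono_succAbove _).monotone)
      refine ⟨c, j.insertNth 0 b, ?_, ?_⟩
      · intro i
        rcases Fin.eq_self_or_eq_succAbove j i with rfl | ⟨i, rfl⟩ <;> simp [hb]
      · rw [Fin.prod_univ_succAbove (fun l => X - C (lam l)) q,
          Fin.prod_univ_succAbove (fun l => X - C (mu l)) j, Fin.sum_univ_succAbove _ j]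
        simp only [Function.comp] at hcb
        rw [hcb, he]
        have key : ∀ i : Fin k, ∏ l ∈ Finset.univ.erase (j.succAbove i), (X - C (mu l)) =
            (X - C (mu j)) * ∏ l ∈ Finset.univ.erase i, (X - C (mu (j.succAbove l))) := by
          intro i
          rw [← Finset.mul_prod_erase (a := j) _ _ (by simp [(Fin.succAbove_ne j i).symm])]
          congr 1
          refine Eq.trans ?_ (Finset.prod_map (Finset.univ.erase i) j.succAboveEmb
            (fun l => X - C (mu l)))
          congr 1
          ext l
          rcases Fin.eq_self_or_eq_succAbove j l with rfl | ⟨l, rfl⟩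
          · simp [Fin.succAbove_ne]
          · simp [Fin.succAbove_ne]
        simp only [key, Fin.insertNth_apply_same, Fin.insertNth_apply_succAbove, C_0, zero_mul,
          zero_add, mul_sub, Finset.mul_sum]
        congr 1
        · ring
        · apply Finset.sum_congr rfl; intros; ring
    · push Not at hs
      have s1 : ∀ j : Fin (k+1), mu j < lam j.castSucc := fun j =>
        lt_of_le_of_ne (h1 _ _ (by simp)) (hs j _ (Or.inl rfl)).symm
      have s2 : ∀ j : Fin (k+1), lam j.succ < mu j := fun j =>
        lt_of_le_of_ne (h2 _ _ (by simp)) (hs j _ (Or.inr rfl))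
      apply aux_weights_strict
      · intro p q h
        exact (s1 p).trans_le (hlam (by simpa [Fin.le_def] using h))
      · intro p q h
        refine lt_of_le_of_lt (hlam ?_) (s2 p)
        simp [Fin.le_def]; omega

lemma aux_det {k : ℕ} (mu : Fin k → ℝ) (c : ℝ) (s : Fin k → ℝ) :
    (Matrix.fromBlocks (Matrix.diagonal (fun j => (mu j : ℂ)))
      (Matrix.of fun i (_ : Fin 1) => (s i : ℂ)) (Matrix.of fun (_ : Fin 1) i => (s i : ℂ))
      (Matrix.of fun _ _ => (c : ℂ))).charpoly =
    (X - C (c:ℂ)) * ∏ j, (X - C (mu j : ℂ))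
        - ∑ j, C ((s j : ℂ)^2) * ∏ i ∈ Finset.univ.erase j, (X - C (mu i : ℂ)) := by
  apply eq_of_infinite_eval_eq
  have hinf : (Set.range (fun j => (mu j : ℂ)))ᶜ.Infinite := (Set.finite_range _).infinite_compl
  refine hinf.mono ?_
  intro x hx
  have hx' : ∀ j, x - mu j ≠ 0 := by
    intro j h
    exact hx ⟨j, (sub_eq_zero.mp h).symm⟩
  simp only [Set.mem_ofPred_eq]
  rw [Matrix.eval_charpoly]
  have e : Matrix.scalar (Fin k ⊕ Fin 1) x - (Matrix.fromBlocks (Matrix.diagonal (fun j => (mu j : ℂ)))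
      (Matrix.of fun i (_ : Fin 1) => (s i : ℂ)) (Matrix.of fun (_ : Fin 1) i => (s i : ℂ))
      (Matrix.of fun _ _ => (c : ℂ))) = (Matrix.fromBlocks (Matrix.diagonal (fun j => (x - mu j : ℂ)))
      (Matrix.of fun i (_ : Fin 1) => (-s i : ℂ)) (Matrix.of fun (_ : Fin 1) i => (-s i : ℂ))
      (Matrix.of fun _ _ => (x - c : ℂ))) := by
    ext (i | i) (j | j)
    · by_cases h : i = j <;> simp [h, Matrix.diagonal_apply]
    · simp
    · simp
    · have : i = j := Subsingleton.elim _ _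
      simp [this]
  rw [e]
  have hu : IsUnit (Matrix.diagonal (fun j => (x - mu j : ℂ))) := by
    rw [Matrix.isUnit_iff_isUnit_det, Matrix.det_diagonal, isUnit_iff_ne_zero, 
      Finset.prod_ne_zero_iff]
    exact fun j _ => hx' j
  letI := hu.invertible
  have hi : ⅟(Matrix.diagonal (fun j => (x - mu j : ℂ))) = Matrix.diagonal (fun j => (x - mu j : ℂ)⁻¹) := by
    apply invOf_eq_right_inv
    rw [Matrix.diagonal_mul_diagonal, ← Matrix.diagonal_one]
    congr 1; ext j; exact mul_inv_cancel₀ (hx' j)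
  rw [Matrix.det_fromBlocks₁₁, hi, Matrix.det_diagonal]
  simp only [Matrix.det_unique, Matrix.sub_apply, Matrix.of_apply, Matrix.mul_apply,
    Matrix.diagonal_apply, eval_sub, eval_mul, eval_X, eval_C, eval_prod, eval_finsetSum]
  simp only [mul_ite, mul_zero, Finset.sum_ite_eq', Finset.mem_univ, if_true, mul_sub,
    Finset.mul_sum]
  congr 1
  · ring
  · apply Finset.sum_congr rfl
    intro j _
    rw [← Finset.mul_prod_erase _ _ (Finset.mem_univ j)]
    field_simp [hx' j]

lemma aux_perm {n : ℕ} (f g : Fin n → ℝ)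
    (h : Multiset.map f Finset.univ.val = Multiset.map g Finset.univ.val) :
    ∃ σ : Equiv.Perm (Fin n), ∀ i, f (σ i) = g i := by
  have hc : ∀ c : ℝ, Nonempty ({i // g i = c} ≃ {i // f i = c}) := by
    intro c
    rw [← Fintype.card_eq, Fintype.card_subtype, Fintype.card_subtype]
    have := congrArg (Multiset.count c) h
    rw [Multiset.count_map, Multiset.count_map] at this
    simp only [eq_comm (a := c)] at this
    exact this.symm
  exact ⟨Equiv.ofFiberEquiv (fun c => (hc c).some), fun i => Equiv.ofFiberEquiv_map _ i⟩

lemma aux_spec {n : ℕ} (A : Matrix (Fin n) (Fin n) ℂ) (hA : A.IsHermitian) (lam : Fin n → ℝ)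
    (h : A.charpoly = ∏ i, (X - C ((lam i : ℝ) : ℂ))) :
    ∃ M : Matrix (Fin n) (Fin n) ℂ, M.conjTranspose * M = 1 ∧
      A = M.conjTranspose * Matrix.diagonal (fun i => (lam i : ℂ)) * M := by
  obtain ⟨σ, hσ⟩ : ∃ σ : Equiv.Perm (Fin n), ∀ i, hA.eigenvalues (σ i) = lam i := by
    apply aux_perm
    have h2 := hA.roots_charpoly_eq_eigenvalues
    rw [h, Polynomial.roots_prod _ _ (by simp [Finset.prod_ne_zero_iff, X_sub_C_ne_zero])] at h2
    simp only [roots_X_sub_C, Multiset.bind_singleton] at h2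
    have h3 := congrArg (Multiset.map Complex.re) h2
    simpa [Multiset.map_map, Function.comp_def] using h3.symm
  set U : Matrix (Fin n) (Fin n) ℂ := (hA.eigenvectorUnitary).1
  have hU : U * star U = 1 := Unitary.coe_mul_star_self _
  refine ⟨(star U).submatrix σ id, ?_, ?_⟩
  · rw [Matrix.conjTranspose_submatrix, Matrix.submatrix_mul_equiv]
    simp [← Matrix.star_eq_conjTranspose, hU]
  · have hd : Matrix.diagonal (fun i => (lam i : ℂ)) =
        (Matrix.diagonal (fun i => (hA.eigenvalues i : ℂ))).submatrix σ σ := by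
      rw [Matrix.submatrix_diagonal_equiv]
      congr 1; ext i; simp [hσ]
    rw [hd, Matrix.conjTranspose_submatrix, Matrix.submatrix_mul_equiv, Matrix.submatrix_mul_equiv]
    have := hA.spectral_theorem
    rw [Unitary.conjStarAlgAut_apply] at this
    simp only [← Matrix.star_eq_conjTranspose, star_star, Matrix.submatrix_id_id]
    exact this

lemma aux_form {n : ℕ} (M : Matrix (Fin n) (Fin n) ℂ) (lam : Fin n → ℝ) (x : Fin n → ℂ) :
    star x ⬝ᵥ ((M.conjTranspose * Matrix.diagonal (fun i => (lam i : ℂ)) * M).mulVec x) =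
      ((∑ i, lam i * Complex.normSq (M.mulVec x i) : ℝ) : ℂ) := by
  rw [← Matrix.mulVec_mulVec, ← Matrix.mulVec_mulVec, Matrix.dotProduct_mulVec,
    ← Matrix.star_mulVec]
  simp only [dotProduct, Matrix.mulVec_diagonal, Complex.ofReal_sum, Complex.ofReal_mul,
    Complex.normSq_eq_conj_mul_self]
  apply Finset.sum_congr rfl
  intro i _
  simp only [Pi.star_apply, RCLike.star_def]
  ring

lemma aux_norm {n : ℕ} (M : Matrix (Fin n) (Fin n) ℂ) (hM : M.conjTranspose * M = 1)
    (x : Fin n → ℂ) :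
    ∑ i, Complex.normSq (M.mulVec x i) = ∑ i, Complex.normSq (x i) := by
  have h1 := aux_form M (fun _ => 1) x
  have h2 := aux_form 1 (fun _ => 1) x
  simp [hM] at h1 h2
  rw [h2] at h1
  exact_mod_cast h1.symm

lemma aux_exists {k : ℕ} (M : Matrix (Fin k) (Fin k) ℂ) (N : Matrix (Fin (k+1)) (Fin (k+1)) ℂ)
    (S : Finset (Fin k)) (T : Finset (Fin (k+1))) (h : S.card + T.card < k) :
    ∃ x : Fin k → ℂ, x ≠ 0 ∧ (∀ i ∈ S, M.mulVec x i = 0) ∧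
      ∀ i ∈ T, N.mulVec (Fin.snoc x 0 : Fin (k+1) → ℂ) i = 0 := by
  let f : (Fin k → ℂ) →ₗ[ℂ] ((S → ℂ) × (T → ℂ)) :=
    LinearMap.prod (LinearMap.pi fun i => LinearMap.proj i.1 ∘ₗ M.mulVecLin)
      (LinearMap.pi fun i => LinearMap.proj i.1 ∘ₗ (N.submatrix id Fin.castSucc).mulVecLin)
  have hf : LinearMap.ker f ≠ ⊥ := by
    apply LinearMap.ker_ne_bot_of_finrank_lt
    simpa using h
  obtain ⟨x, hx, hx0⟩ := (Submodule.ne_bot_iff _).mp hf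
  have hx' : f x = 0 := hx
  refine ⟨x, hx0, fun i hi => ?_, fun i hi => ?_⟩
  · exact congrFun (congrArg Prod.fst hx') ⟨i, hi⟩
  · have := congrFun (congrArg Prod.snd hx') ⟨i, hi⟩
    change (N.submatrix id Fin.castSucc).mulVec x i = 0 at this
    refine Eq.trans ?_ this
    simp [Matrix.mulVec, dotProduct, Fin.sum_univ_castSucc]

lemma aux_snoc {k : ℕ} (A : Matrix (Fin (k+1)) (Fin (k+1)) ℂ) (x : Fin k → ℂ) :
    star (Fin.snoc x 0 : Fin (k+1) → ℂ) ⬝ᵥ (A.mulVec (Fin.snoc x 0 : Fin (k+1) → ℂ)) =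
    star x ⬝ᵥ ((A.submatrix Fin.castSucc Fin.castSucc).mulVec x) := by
  simp [Matrix.mulVec, dotProduct, Fin.sum_univ_castSucc]

lemma aux_cauchy {k : ℕ} (lam : Fin (k + 1) → ℝ) (mu : Fin k → ℝ)
    (hlam : Antitone lam) (hmu : Antitone mu)
    (A : Matrix (Fin (k + 1)) (Fin (k + 1)) ℂ) (hA : A.IsHermitian)
    (h1 : A.charpoly = ∏ i, (X - C ((lam i : ℝ) : ℂ)))
    (h2 : (A.submatrix Fin.castSucc Fin.castSucc).charpoly = ∏ j, (X - C ((mu j : ℝ) : ℂ)))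
    (j : Fin k) : mu j ≤ lam j.castSucc ∧ lam j.succ ≤ mu j := by
  obtain ⟨N, hN, hAN⟩ := aux_spec A hA lam h1
  obtain ⟨M, hM, hBM⟩ := aux_spec _ (hA.submatrix Fin.castSucc) mu h2
  have hform : ∀ x : Fin k → ℂ, ∑ i, mu i * Complex.normSq (M.mulVec x i) =
      ∑ i, lam i * Complex.normSq (N.mulVec (Fin.snoc x 0 : Fin (k+1) → ℂ) i) := by
    intro x
    have := aux_snoc A x
    rw [hBM, aux_form] at this
    nth_rw 1 [hAN] at this
    rw [aux_form] at this
    exact_mod_cast this.symm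
  have hn1 := fun x => aux_norm M hM x
  have hn2 : ∀ x : Fin k → ℂ,
      ∑ i, Complex.normSq (N.mulVec (Fin.snoc x 0 : Fin (k+1) → ℂ) i) =
        ∑ i, Complex.normSq (x i) := by
    intro x
    rw [aux_norm N hN]
    simp [Fin.sum_univ_castSucc]
  have hpos : ∀ x : Fin k → ℂ, x ≠ 0 → 0 < ∑ i, Complex.normSq (x i) := by
    intro x hx
    obtain ⟨i, hi⟩ := Function.ne_iff.mp hx
    exact Finset.sum_pos' (fun _ _ => Complex.normSq_nonneg _)
      ⟨i, Finset.mem_univ _, Complex.normSq_pos.mpr hi⟩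
  constructor
  · obtain ⟨x, hx, hS, hT⟩ := aux_exists M N (Finset.Ioi j) (Finset.Iio j.castSucc)
      (by simp; omega)
    have a1 : mu j * ∑ i, Complex.normSq (x i) ≤ ∑ i, mu i * Complex.normSq (M.mulVec x i) := by
      rw [← hn1, Finset.mul_sum]
      apply Finset.sum_le_sum
      intro i _
      by_cases hi : j < i
      · simp [hS i (by simpa using hi)]
      · exact mul_le_mul_of_nonneg_right (hmu (not_lt.mp hi)) (Complex.normSq_nonneg _)
    have a2 : ∑ i, lam i * Complex.normSq (N.mulVec (Fin.snoc x 0 : Fin (k+1) → ℂ) i) ≤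
        lam j.castSucc * ∑ i, Complex.normSq (x i) := by
      rw [← hn2, Finset.mul_sum]
      apply Finset.sum_le_sum
      intro i _
      by_cases hi : i < j.castSucc
      · simp [hT i (by simpa using hi)]
      · exact mul_le_mul_of_nonneg_right (hlam (not_lt.mp hi)) (Complex.normSq_nonneg _)
    rw [← hform] at a2
    exact le_of_mul_le_mul_right (a1.trans a2) (hpos x hx)
  · obtain ⟨x, hx, hS, hT⟩ := aux_exists M N (Finset.Iio j) (Finset.Ioi j.succ)
      (by simp; omega)
    have a1 : ∑ i, mu i * Complex.normSq (M.mulVec x i) ≤ mu j * ∑ i, Complex.normSq (x i) := by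
      rw [← hn1, Finset.mul_sum]
      apply Finset.sum_le_sum
      intro i _
      by_cases hi : i < j
      · simp [hS i (by simpa using hi)]
      · exact mul_le_mul_of_nonneg_right (hmu (not_lt.mp hi)) (Complex.normSq_nonneg _)
    have a2 : lam j.succ * ∑ i, Complex.normSq (x i) ≤
        ∑ i, lam i * Complex.normSq (N.mulVec (Fin.snoc x 0 : Fin (k+1) → ℂ) i) := by
      rw [← hn2, Finset.mul_sum]
      apply Finset.sum_le_sum
      intro i _
      by_cases hi : j.succ < i
      · simp [hT i (by simpa using hi)]
      · exact mul_le_mul_of_nonneg_right (hlam (not_lt.mp hi)) (Complex.normSq_nonneg _)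
    rw [← hform] at a2
    exact le_of_mul_le_mul_right (a2.trans a1) (hpos x hx)

/-- **Cauchy interlacing and its converse.**
Let `λ⁽ᵏ⁺¹⁾ = (λ₁ ≥ ⋯ ≥ λ_{k+1})` and `λ⁽ᵏ⁾ = (μ₁ ≥ ⋯ ≥ μ_k)` be weakly decreasing real
sequences.  There exists a `(k+1) × (k+1)` Hermitian matrix with eigenvalues `λ₁, …, λ_{k+1}`
whose upper-left `k × k` submatrix has eigenvalues `μ₁, …, μ_k` if and only if the interlacing
inequalities `λⱼ ≥ μⱼ ≥ λⱼ₊₁` hold for all `1 ≤ j ≤ k`.  (Having the prescribed eigenvalues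
is expressed via the characteristic polynomial, which for a Hermitian matrix splits with
real roots.) -/
theorem hermitian_interlacing_iff (k : ℕ) (lam : Fin (k + 1) → ℝ) (mu : Fin k → ℝ)
    (hlam : Antitone lam) (hmu : Antitone mu) :
    (∃ A : Matrix (Fin (k + 1)) (Fin (k + 1)) ℂ, A.IsHermitian ∧
        A.charpoly = ∏ i, (X - C ((lam i : ℝ) : ℂ)) ∧
        (A.submatrix Fin.castSucc Fin.castSucc).charpoly = ∏ j, (X - C ((mu j : ℝ) : ℂ))) ↔
      ∀ j : Fin k, mu j ≤ lam j.castSucc ∧ lam j.succ ≤ mu j := by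
  constructor
  · rintro ⟨A, hA, h1, h2⟩ j
    exact aux_cauchy lam mu hlam hmu A hA h1 h2 j
  · intro h
    obtain ⟨c, b, hb, hcb⟩ := aux_weights k lam mu
      (fun p q hpq => (h p).1.trans (hlam (by simpa [Fin.le_def] using hpq)))
      (fun p q hpq => (hlam (by simp [Fin.le_def]; omega)).trans (h p).2) hlam hmu
    have hdet := aux_det mu c (fun j => Real.sqrt (b j))
    set F := (Matrix.fromBlocks (Matrix.diagonal (fun j => (mu j : ℂ)))
      (Matrix.of fun i (_ : Fin 1) => (Real.sqrt (b i) : ℂ))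
      (Matrix.of fun (_ : Fin 1) i => (Real.sqrt (b i) : ℂ))
      (Matrix.of fun _ _ => (c : ℂ))) with hF
    have hFh : F.IsHermitian := by
      ext (i | i) (j | j)
      · by_cases hij : i = j
        · simp [hF, hij]
        · simp [hF, hij, Ne.symm hij]
      all_goals simp [hF]
    refine ⟨Matrix.reindex finSumFinEquiv finSumFinEquiv F, ?_, ?_, ?_⟩
    · exact hFh.submatrix _
    · rw [Matrix.charpoly_reindex, hdet]
      have := congrArg (Polynomial.map Complex.ofRealHom) hcb
      simp only [Polynomial.map_prod, Polynomial.map_sub, Polynomial.map_mul, Polynomial.map_X,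
        Polynomial.map_C, Polynomial.map_sum, Complex.ofRealHom_eq_coe] at this
      rw [this]
      congr 1
      apply Finset.sum_congr rfl
      intro j _
      rw [← Complex.ofReal_pow, Real.sq_sqrt (hb j)]
    · have : (Matrix.reindex finSumFinEquiv finSumFinEquiv F).submatrix Fin.castSucc Fin.castSucc
          = Matrix.diagonal (fun j => (mu j : ℂ)) := by
        ext i j
        have e : ∀ i : Fin k, finSumFinEquiv.symm i.castSucc = (Sum.inl i : Fin k ⊕ Fin 1) := by
          intro i
          rw [Equiv.symm_apply_eq]; rfl
        simp [e, hF]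
      rw [this, Matrix.charpoly_diagonal]
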